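/- For every prime p ≥ 5, deg ss_p^{(2*)}(X) = L^{(2*)}(p) if and only if p divides #𝔹, the order of the Baby monster group (equivalently, if and only if p ∈ {5, 7, 11, 13, 17, 19, 23, 31, 47}). -/

import Mathlib

open Polynomial

noncomputable section

/-- The class number h(√-d) of the imaginary quadratic field ℚ(√-d),
realized as the subfield of ℂ generated by i·√d. -/
def classNumberSqrtNeg (d : ℕ) : ℕ :=
  haveI : FiniteDimensional ℚ (IntermediateField.adjoin ℚ {(Complex.I * Real.sqrt d : ℂ)}) :=
    IntermediateField.adjoin.finiteDimensional
      ⟨X ^ 2 + C (d : ℚ), monic_X_pow_add_C _ (by norm_num), by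
        have h : (Complex.I * (Real.sqrt d : ℂ)) ^ 2 = -(d : ℂ) := by
          rw [mul_pow, Complex.I_sq, ← Complex.ofReal_pow, Real.sq_sqrt (Nat.cast_nonneg d)]
          simp
        simp [h]⟩
  haveI : NumberField (IntermediateField.adjoin ℚ {(Complex.I * Real.sqrt d : ℂ)}) := ⟨⟩
  NumberField.classNumber (IntermediateField.adjoin ℚ {(Complex.I * Real.sqrt d : ℂ)})

variable (p : ℕ) [Fact p.Prime]

/-- ε = (1 - (-1|p))/2 -/
def eps : ℕ := ((1 - legendreSym p (-1)) / 2).toNat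
/-- δ = (1 - (-3|p))/2 -/
def del : ℕ := ((1 - legendreSym p (-3)) / 2).toNat
/-- ν = (1 - (-2|p))/2 -/
def nu : ℕ := ((1 - legendreSym p (-2)) / 2).toNat

/-- The Pochhammer symbol (x)_n = x(x+1)⋯(x+n-1) in 𝔽_p. -/
def poch (x : ZMod p) (n : ℕ) : ZMod p := (ascPochhammer (ZMod p) n).eval x

/-- The level-2 Fricke supersingular polynomial ss_p^{(2*)}(X) ∈ 𝔽_p[X]:
(X-256)^ν · Σ_{n=0}^{m₂} ((-m₂)_n (β₂)_n / (n!)²) 256^n X^{m₂+ε-n},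
with m₂ = ⌊p/8⌋ and β₂ = 3/8 - (ε-2ν)/4. -/
def ss2Star : (ZMod p)[X] :=
  (X - C 256) ^ nu p *
    ∑ n ∈ Finset.range (p / 8 + 1),
      C (poch p (-(p / 8 : ℕ) : ZMod p) n *
         poch p ((3 : ZMod p) / 8 - ((((eps p : ℤ) - 2 * (nu p : ℤ)) : ℤ) : ZMod p) / 4) n /
         ((n.factorial : ZMod p)) ^ 2 * 256 ^ n) *
      X ^ (p / 8 + eps p - n)

/-- L^{(2*)}(p): the number of distinct roots of ss_p^{(2*)}(X) in 𝔽_p. -/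
def L2Star : ℕ := (ss2Star p).roots.toFinset.card

/-- The order of the Monster simple group 𝕄. -/
def monsterOrder : ℕ :=
  2 ^ 46 * 3 ^ 20 * 5 ^ 9 * 7 ^ 6 * 11 ^ 2 * 13 ^ 3 * 17 * 19 * 23 * 29 * 31 * 41 * 47 * 59 * 71

/-- The order of the Baby monster group 𝔹. -/
def babyMonsterOrder : ℕ :=
  2 ^ 41 * 3 ^ 13 * 5 ^ 6 * 7 ^ 2 * 11 * 13 * 17 * 19 * 23 * 31 * 47

/-- The order of Fischer's sporadic group Fi′₂₄. -/
def fischer24Order : ℕ :=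
  2 ^ 21 * 3 ^ 16 * 5 ^ 2 * 7 ^ 3 * 11 * 13 * 17 * 23 * 29

section Forms

variable {F : Type*} [Field F]

theorem coeff_coeff_swap (f : F[X][X]) (i j : ℕ) :
    ((Bivariate.swap f).coeff i).coeff j = (f.coeff j).coeff i := by
  induction f using Polynomial.induction_on' with
  | add f g hf hg => simp [hf, hg]
  | monomial n g =>
    induction g using Polynomial.induction_on' with
    | add f g hf hg => simp only [map_add, coeff_add, hf, hg]
    | monomial m a =>
      rw [Bivariate.swap_monomial_monomial]
      simp only [coeff_monomial]
      split_ifs <;> simp_all [coeff_monomial]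

/-- Differentiation of the coefficients of a bivariate polynomial. -/
def coeffDeriv : F[X][X] →ₗ[F] F[X][X] :=
  Bivariate.swap.toLinearMap ∘ₗ (derivative.restrictScalars F) ∘ₗ Bivariate.swap.toLinearMap

theorem coeff_coeffDeriv (f : F[X][X]) (j : ℕ) :
    (coeffDeriv f).coeff j = derivative (f.coeff j) := by
  ext i
  simp only [coeffDeriv, LinearMap.comp_apply, AlgEquiv.toLinearMap_apply,
    LinearMap.restrictScalars_apply]
  rw [coeff_coeff_swap, coeff_derivative, coeff_derivative, ← coeff_coeff_swap f]
  rw [show ((i : F[X]) + 1) = C ((i : F) + 1) by simp, coeff_mul_C]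

/-- The Riccati operator on forms of degree `D` in two variables, written in dehomogenized
form. It describes the derivation `-(X - e) X d/dX` on forms in a solution of a hypergeometric
equation and its logarithmic derivative. -/
def riccati (e κ μ : F) (D : ℕ) : F[X][X] →ₗ[F] F[X][X] :=
  LinearMap.mulLeft F (-C (X * (X - C e))) ∘ₗ coeffDeriv +
    LinearMap.mulLeft F (C (X - C e) - C (C κ) * X + C (C μ) * X ^ 2) ∘ₗ
      (derivative.restrictScalars F) +
    LinearMap.mulLeft F ((D : F[X][X]) * (C (C κ) - C (C μ) * X))

theorem riccati_apply (e κ μ : F) (D : ℕ) (f : F[X][X]) :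
    riccati e κ μ D f = -C (X * (X - C e)) * coeffDeriv f +
      (C (X - C e) - C (C κ) * X + C (C μ) * X ^ 2) * derivative f +
      (D : F[X][X]) * (C (C κ) - C (C μ) * X) * f := rfl

theorem coeff_riccati_zero (e κ μ : F) (D : ℕ) (f : F[X][X]) :
    (riccati e κ μ D f).coeff 0 = -(X * (X - C e)) * derivative (f.coeff 0) +
      (X - C e) * f.coeff 1 + (D : F[X]) * C κ * f.coeff 0 := by
  rw [riccati_apply, ← C_neg, ← C_eq_natCast]
  simp only [add_mul, sub_mul, mul_sub, mul_assoc, coeff_add, coeff_sub, coeff_C_mul,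
    coeff_coeffDeriv, coeff_X_mul_zero, pow_two, coeff_derivative]
  simp

theorem coeff_riccati_succ (e κ μ : F) (D : ℕ) (f : F[X][X]) (j : ℕ) :
    (riccati e κ μ D f).coeff (j + 1) = -(X * (X - C e)) * derivative (f.coeff (j + 1)) +
      ((j : F[X]) + 2) * (X - C e) * f.coeff (j + 2) +
      ((D : F[X]) - (j : F[X]) - 1) * C κ * f.coeff (j + 1) -
      ((D : F[X]) - (j : F[X])) * C μ * f.coeff j := by
  rw [riccati_apply, ← C_neg, ← C_eq_natCast]
  cases j with
  | zero =>
    simp only [add_mul, sub_mul, mul_sub, mul_assoc, coeff_add, coeff_sub, coeff_C_mul,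
      coeff_coeffDeriv, coeff_X_mul, pow_two, coeff_derivative, coeff_X_mul_zero]
    simp
    ring
  | succ j =>
    simp only [add_mul, sub_mul, mul_sub, mul_assoc, coeff_add, coeff_sub, coeff_C_mul,
      coeff_coeffDeriv, coeff_X_mul, pow_two, coeff_derivative]
    push_cast
    simp
    ring

theorem natDegree_riccati_le (e κ μ : F) {D : ℕ} {f : F[X][X]} (hf : f.natDegree ≤ D) :
    (riccati e κ μ D f).natDegree ≤ D := by
  rw [natDegree_le_iff_coeff_eq_zero] at hf ⊢
  rintro (_ | j) hj
  · omega
  rw [coeff_riccati_succ, hf _ hj, hf _ (by omega : D < j + 2)]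
  rcases Nat.lt_or_ge D j with h | h
  · simp [hf _ h]
  · obtain rfl : D = j := by omega
    simp

theorem natDegree_coeff_riccati_le (e κ μ : F) (D : ℕ) {f : F[X][X]} {d : ℕ}
    (hf : ∀ j, (f.coeff j).natDegree ≤ d) (j : ℕ) :
    ((riccati e κ μ D f).coeff j).natDegree ≤ d + 1 := by
  have h1 (j : ℕ) : (-(X * (X - C e)) * derivative (f.coeff j)).natDegree ≤ d + 1 := by
    rcases Nat.eq_zero_or_pos (f.coeff j).natDegree with h | h
    · rw [eq_C_of_natDegree_eq_zero h]; simp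
    · have := natDegree_derivative_lt h.ne'
      have := hf j
      refine natDegree_mul_le.trans ?_
      have : (-(X * (X - C e))).natDegree ≤ 2 := by compute_degree
      omega
  have h2 (c : F[X]) (hc : c.natDegree ≤ 1) (j : ℕ) : (c * f.coeff j).natDegree ≤ d + 1 := by
    refine natDegree_mul_le.trans ?_
    have := hf j
    omega
  cases j with
  | zero =>
    rw [coeff_riccati_zero]
    exact natDegree_add_le_of_degree_le (natDegree_add_le_of_degree_le (h1 _)
      (h2 _ (by compute_degree) _)) (h2 _ (by rw [← C_eq_natCast, ← C_mul, natDegree_C]; omega) _)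
  | succ j =>
    rw [coeff_riccati_succ]
    refine natDegree_sub_le_of_le (natDegree_add_le_of_degree_le
      (natDegree_add_le_of_degree_le (h1 _) (h2 _ ?_ _)) (h2 _ ?_ _)) (h2 _ ?_ _) |>.trans_eq
      (max_self _)
    · rw [show ((j : F[X]) + 2) = C ((j : F) + 2) by simp [map_ofNat]]; compute_degree
    · rw [show ((D : F[X]) - j - 1) = C ((D : F) - j - 1) by simp, ← C_mul, natDegree_C]; omega
    · rw [show ((D : F[X]) - j) = C ((D : F) - j) by simp, ← C_mul, natDegree_C]; omega

/-- The value at `(P, Z)` of the degree `D` homogenization of `f`. -/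
def homEval (P Z : F[X]) (D : ℕ) (f : F[X][X]) : F[X] :=
  MvPolynomial.aeval ![P, Z] (f.homogenize D)

section
variable (P Z : F[X]) (D : ℕ)

theorem homEval_add (f g : F[X][X]) :
    homEval P Z D (f + g) = homEval P Z D f + homEval P Z D g := by
  simp [homEval]

theorem homEval_zero : homEval P Z D 0 = 0 := by simp [homEval]

theorem homEval_sub (f g : F[X][X]) :
    homEval P Z D (f - g) = homEval P Z D f - homEval P Z D g := by
  simp [homEval, sub_eq_add_neg, homogenize_neg]

theorem homEval_C_mul (c : F[X]) (f : F[X][X]) :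
    homEval P Z D (C c * f) = c * homEval P Z D f := by
  simp [homEval]

variable {D} in
theorem homEval_monomial {j : ℕ} (hj : j ≤ D) (c : F[X]) :
    homEval P Z D (monomial j c) = c * P ^ j * Z ^ (D - j) := by
  rw [← C_mul_X_pow_eq_monomial, homEval_C_mul, homEval, homogenize_X_pow hj]
  simp [mul_assoc]

theorem homEval_C (c : F[X]) : homEval P Z D (C c) = c * Z ^ D := by
  simp [homEval]

theorem homEval_mul {m n : ℕ} {f g : F[X][X]} (hf : f.natDegree ≤ m) (hg : g.natDegree ≤ n) :
    homEval P Z (m + n) (f * g) = homEval P Z m f * homEval P Z n g := by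
  simp [homEval, homogenize_mul f g hf hg]

theorem homEval_X_mul {f : F[X][X]} (hf : f.natDegree ≤ D) :
    homEval P Z (D + 1) (X * f) = P * homEval P Z D f := by
  rw [add_comm D 1, homEval_mul P Z (natDegree_X_le) hf]
  congr 1
  simp [homEval, homogenize_X]

variable {D} in
theorem homEval_succ {f : F[X][X]} (hf : f.natDegree ≤ D + 1) :
    homEval P Z (D + 1) f = P * homEval P Z D f.divX + f.coeff 0 * Z ^ (D + 1) := by
  conv_lhs => rw [← divX_mul_X_add f]
  rw [homEval_add, mul_comm, homEval_X_mul, homEval_C]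
  rw [natDegree_divX_eq_natDegree_tsub_one]
  omega

variable {D} in
theorem dvd_homEval_sub {f : F[X][X]} (hf : f.natDegree ≤ D) :
    P ∣ homEval P Z D f - f.coeff 0 * Z ^ D := by
  cases D with
  | zero =>
    rw [eq_C_of_natDegree_le_zero hf, homEval_C]
    simp
  | succ D => simp [homEval_succ P Z hf]

variable {P Z} in
/-- A form with coefficients of degree less than that of `P` is determined by its value at
`(P, Z)` if `P` and `Z` are coprime. -/
theorem eq_zero_of_homEval_eq_zero (h : IsCoprime P Z) {D : ℕ} {f : F[X][X]}
    (hf : f.natDegree ≤ D) (hc : ∀ j, (f.coeff j).natDegree < P.natDegree)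
    (h0 : homEval P Z D f = 0) : f = 0 := by
  have hP : P ≠ 0 := by rintro rfl; simpa using hc 0
  induction D generalizing f with
  | zero =>
    rw [eq_C_of_natDegree_le_zero hf, homEval_C] at h0
    rw [eq_C_of_natDegree_le_zero hf]
    simpa using h0
  | succ D ih =>
    have h1 := h0
    rw [homEval_succ P Z hf] at h1
    have h2 : f.coeff 0 = 0 := by
      have : P ∣ f.coeff 0 * Z ^ (D + 1) :=
        (dvd_add_right (dvd_mul_right P _)).1 (h1 ▸ dvd_zero P)
      exact eq_zero_of_dvd_of_natDegree_lt ((h.pow_right).dvd_of_dvd_mul_right this) (hc 0)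
    rw [h2, zero_mul, add_zero, mul_eq_zero, or_iff_right hP] at h1
    have := ih (f := f.divX) (by rw [natDegree_divX_eq_natDegree_tsub_one]; omega)
      (fun j => by simpa [coeff_divX] using hc (j + 1)) h1
    rw [← divX_mul_X_add f, this, h2]
    simp

end

/-- The derivation `-(X - e) X d/dX`, twisted so as to vanish on `X ^ w`. -/
def twistedDeriv (e : F) (w : ℕ) (g : F[X]) : F[X] :=
  (X - C e) * ((w : F[X]) * g - X * derivative g)

theorem riccati_monomial (e κ μ : F) (j k : ℕ) (c : F[X]) :
    riccati e κ μ (j + k) (monomial j c) =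
      monomial j (-(X * (X - C e)) * derivative c + (k : F[X]) * C κ * c) +
      monomial (j - 1) ((j : F[X]) * (X - C e) * c) -
      monomial (j + 1) ((k : F[X]) * C μ * c) := by
  have h : coeffDeriv (monomial j c) = monomial j (derivative c) := by
    ext1 i
    rw [coeff_coeffDeriv, coeff_monomial, coeff_monomial]
    split_ifs <;> simp
  rw [riccati_apply, h, derivative_monomial]
  cases j with
  | zero =>
    simp only [← C_mul_X_pow_eq_monomial]
    simp
    ring
  | succ j =>
    simp only [← C_mul_X_pow_eq_monomial, Nat.add_sub_cancel]
    simp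
    ring

theorem homEval_riccati {e κ μ : F} {m : ℕ} {P Z : F[X]}
    (hP : X * derivative P = (m : F[X]) * P - Z)
    (hZ : twistedDeriv e m Z = C κ * Z - C μ * P) {D : ℕ} {f : F[X][X]} (hf : f.natDegree ≤ D) :
    homEval P Z D (riccati e κ μ D f) = twistedDeriv e (m * D) (homEval P Z D f) := by
  rw [twistedDeriv] at hZ
  refine Polynomial.induction_with_natDegree_le (fun f => homEval P Z D (riccati e κ μ D f) =
    twistedDeriv e (m * D) (homEval P Z D f)) D ?_ ?_ ?_ f hf
  · simp [homEval_zero, twistedDeriv]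
  · intro j c _ hj
    obtain ⟨k, rfl⟩ := Nat.exists_eq_add_of_le hj
    rw [C_mul_X_pow_eq_monomial, riccati_monomial, homEval_sub, homEval_add,
      homEval_monomial P Z hj, homEval_monomial P Z hj, homEval_monomial P Z (by omega),
      twistedDeriv]
    have h3 : homEval P Z (j + k) (monomial (j + 1) ((k : F[X]) * C μ * c)) =
        (k : F[X]) * C μ * c * P ^ (j + 1) * Z ^ (k - 1) := by
      cases k with
      | zero => simp [homEval_zero]
      | succ k =>
        rw [homEval_monomial P Z (by omega), show j + (k + 1) - (j + 1) = k + 1 - 1 by omega]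
    rw [h3, Nat.add_sub_cancel_left]
    rcases j with _ | j <;> rcases k with _ | k <;>
      simp only [derivative_mul, derivative_pow, Nat.add_sub_cancel, Nat.cast_zero, pow_zero,
        derivative_one, C_eq_natCast]
    · push_cast
      ring
    · push_cast
      rw [show 0 + (k + 1) - (0 - 1) = k + 1 by omega]
      linear_combination (-c * (k + 1) * Z ^ k) * hZ
    · push_cast
      rw [show j + 1 + 0 - j = 1 by omega]
      linear_combination ((X - C e) * c * (j + 1) * P ^ j) * hP
    · push_cast
      rw [show j + 1 + (k + 1) - j = k + 2 by omega]
      linear_combination ((X - C e) * c * (j + 1) * P ^ j * Z ^ (k + 1)) * hP -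
        (c * P ^ (j + 1) * (k + 1) * Z ^ k) * hZ
  · intro f g _ _ hf hg
    rw [map_add, homEval_add, hf, hg, homEval_add]
    simp only [twistedDeriv, derivative_add]
    ring

theorem dvd_pow_succ_of_dvd_twistedDeriv (p : ℕ) [CharP F p] {e : F} {P : F[X]}
    (hP : IsCoprime P ((X - C e) * (X * derivative P))) (w : ℕ) {k : ℕ} (hk : k < p) {g : F[X]}
    (hg : P ∣ g) (hE : P ^ k ∣ twistedDeriv e w g) : P ^ (k + 1) ∣ g := by
  have key (j : ℕ) (hj : j ≤ k) : P ^ (j + 1) ∣ g := by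
    induction j with
    | zero => simpa using hg
    | succ j ih =>
      obtain ⟨h, rfl⟩ := ih (by omega)
      rcases eq_or_ne P 0 with rfl | hP0
      · simp
      have h1 : twistedDeriv e w (P ^ (j + 1) * h) =
          P ^ j * (P * ((X - C e) * ((w : F[X]) * h - X * derivative h)) -
            C ((j : F) + 1) * ((X - C e) * (X * derivative P)) * h) := by
        simp only [twistedDeriv, derivative_mul, derivative_pow, Nat.add_sub_cancel]
        push_cast
        simp
        ring
      have h2 := (pow_dvd_pow P hj).trans hE
      rw [h1, pow_succ, mul_dvd_mul_iff_left (pow_ne_zero _ hP0),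
        dvd_sub_right (dvd_mul_right _ _)] at h2
      have h3 : ((j : F) + 1) ≠ 0 := by
        have := mt (CharP.cast_eq_zero_iff F p (j + 1)).1
          (fun h => absurd (Nat.le_of_dvd (by omega) h) (by omega))
        simpa using this
      rw [mul_assoc, (isUnit_C.2 h3.isUnit).dvd_mul_left] at h2
      rw [pow_succ _ (j + 1)]
      exact mul_dvd_mul_left _ (hP.dvd_of_dvd_mul_left h2)
  exact key k le_rfl

theorem pow_dvd_of_dvd_iterate_twistedDeriv (p : ℕ) [CharP F p] {e : F} {P : F[X]}
    (hP : IsCoprime P ((X - C e) * (X * derivative P))) (w : ℕ) {M : ℕ} (hM : M ≤ p) {g : F[X]}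
    (h : ∀ n < M, P ∣ (twistedDeriv e w)^[n] g) : P ^ M ∣ g := by
  induction M generalizing g with
  | zero => simp
  | succ M ih =>
    refine dvd_pow_succ_of_dvd_twistedDeriv p hP w (by omega) (h 0 (by omega))
      (ih (by omega) fun n hn => ?_)
    rw [← Function.iterate_succ_apply]
    exact h (n + 1) (by omega)

/-- If the logarithmic derivatives of two polynomials of degree less than the characteristic differ
by a constant, then this constant vanishes and the degrees agree. -/
theorem natDegree_eq_of_wronskian (p : ℕ) [CharP F p] {r s : F} {f g : F[X]} (hf : f ≠ 0)
    (hg : g ≠ 0) (hfp : f.natDegree < p) (hgp : g.natDegree < p)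
    (h : f * (-C s * g + derivative g) = g * (-C r * f + derivative f)) :
    r = s ∧ f.natDegree = g.natDegree := by
  have hfg : f.leadingCoeff * g.leadingCoeff ≠ 0 := by simp [hf, hg]
  have hrs : r = s := by
    have h1 : C (r - s) * (f * g) = g * derivative f - f * derivative g := by
      rw [C_sub]
      linear_combination h
    by_contra hne
    have h4 : (g * derivative f - f * derivative g).degree < (f * g).degree := by
      rw [degree_mul]
      refine (degree_sub_le _ _).trans_lt (max_lt ?_ ?_)
      · rw [degree_mul, add_comm]
        exact WithBot.add_lt_add_right (degree_eq_bot.not.2 hg) (degree_derivative_lt hf)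
      · rw [degree_mul]
        exact WithBot.add_lt_add_left (degree_eq_bot.not.2 hf) (degree_derivative_lt hg)
    rw [← h1, degree_C_mul (sub_ne_zero.2 hne)] at h4
    exact lt_irrefl _ h4
  refine ⟨hrs, ?_⟩
  subst hrs
  have h1 : f * derivative g = g * derivative f := by linear_combination h
  have h2 (f g : F[X]) : (f * (X * derivative g)).coeff (f.natDegree + g.natDegree) =
      f.leadingCoeff * g.leadingCoeff * g.natDegree := by
    rw [coeff_mul_add_eq_of_natDegree_le le_rfl]
    · cases hn : g.natDegree with
      | zero => simp
      | succ n =>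
        rw [coeff_X_mul, coeff_derivative, leadingCoeff, leadingCoeff, hn]
        push_cast
        ring
    · cases hn : g.natDegree with
      | zero => rw [eq_C_of_natDegree_eq_zero hn]; simp
      | succ n =>
        refine natDegree_mul_le.trans ?_
        have := natDegree_derivative_lt (p := g) (by omega)
        rw [natDegree_X]
        omega
  have h3 := h2 f g
  rw [mul_left_comm, h1, mul_left_comm, add_comm, h2 g f, mul_comm g.leadingCoeff] at h3
  exact CharP.natCast_injOn_Iio F p hfp hgp (mul_left_cancel₀ hfg h3)

theorem natDegree_swap_le {f : F[X][X]} {d : ℕ} (hf : ∀ j, (f.coeff j).natDegree ≤ d) :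
    (Bivariate.swap f).natDegree ≤ d := by
  rw [natDegree_le_iff_coeff_eq_zero]
  intro n hn
  ext j
  rw [coeff_coeff_swap, coeff_zero, coeff_eq_zero_of_natDegree_lt ((hf j).trans_lt hn)]

theorem natDegree_coeff_le_swap (f : F[X][X]) (j : ℕ) :
    (f.coeff j).natDegree ≤ (Bivariate.swap f).natDegree := by
  rw [natDegree_le_iff_coeff_eq_zero]
  intro n hn
  rw [← coeff_coeff_swap, coeff_eq_zero_of_natDegree_lt hn, coeff_zero]

theorem natDegree_coeff_swap_le (f : F[X][X]) (i : ℕ) :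
    ((Bivariate.swap f).coeff i).natDegree ≤ f.natDegree := by
  rw [natDegree_le_iff_coeff_eq_zero]
  intro n hn
  rw [coeff_coeff_swap, coeff_eq_zero_of_natDegree_lt hn, coeff_zero]

theorem natDegree_coeff_mul_le {f g : F[X][X]} {c d : ℕ} (hf : ∀ j, (f.coeff j).natDegree ≤ c)
    (hg : ∀ j, (g.coeff j).natDegree ≤ d) (j : ℕ) : ((f * g).coeff j).natDegree ≤ c + d := by
  rw [coeff_mul]
  exact natDegree_sum_le_of_forall_le _ _ fun x _ =>
    natDegree_mul_le.trans (add_le_add (hf _) (hg _))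

theorem coeff_swap_riccati {e κ μ : F} {f : F[X][X]} {d : ℕ}
    (hd : (Bivariate.swap f).natDegree ≤ d) :
    (Bivariate.swap (riccati e κ μ 0 f)).coeff (d + 1) =
      -C (d : F) * (Bivariate.swap f).coeff d + derivative ((Bivariate.swap f).coeff d) := by
  have hj (j : ℕ) : (f.coeff j).coeff (d + 1) = 0 :=
    coeff_eq_zero_of_natDegree_lt ((natDegree_coeff_le_swap f j).trans_lt (by omega))
  have hj' (j : ℕ) : (f.coeff j).coeff (d + 2) = 0 :=
    coeff_eq_zero_of_natDegree_lt ((natDegree_coeff_le_swap f j).trans_lt (by omega))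
  have h1 (j : ℕ) : (-(X * (X - C e)) * derivative (f.coeff j)).coeff (d + 1) =
      -(d : F) * (f.coeff j).coeff d := by
    rw [show -(X * (X - C e)) * derivative (f.coeff j) = C e * (X * derivative (f.coeff j)) -
      X * (X * derivative (f.coeff j)) by ring, coeff_sub, coeff_C_mul, coeff_X_mul, coeff_X_mul,
      coeff_derivative, hj]
    cases d with
    | zero => simp
    | succ d => rw [coeff_X_mul, coeff_derivative]; push_cast; ring
  have h2 (c : F) (j : ℕ) : (C c * (X - C e) * f.coeff j).coeff (d + 1) =
      c * (f.coeff j).coeff d := by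
    rw [show C c * (X - C e) * f.coeff j = C c * (X * f.coeff j - C e * f.coeff j) by ring,
      coeff_C_mul, coeff_sub, coeff_X_mul, coeff_C_mul, hj]
    ring
  ext j
  rw [coeff_coeff_swap, ← C_neg, coeff_add, coeff_C_mul, coeff_derivative, coeff_coeff_swap,
    coeff_coeff_swap]
  cases j with
  | zero =>
    have := h2 1 1
    rw [C_1, one_mul] at this
    rw [coeff_riccati_zero, coeff_add, coeff_add, h1, this]
    simp
  | succ j =>
    have := h2 ((j : F) + 2) (j + 2)
    rw [show C ((j : F) + 2) = (j : F[X]) + 2 by simp [map_ofNat]] at this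
    rw [coeff_riccati_succ, coeff_sub, coeff_add, coeff_add, h1, this,
      show ((((0 : ℕ) : F[X]) - (j : F[X]) - 1) * C κ * f.coeff (j + 1)) =
        C ((-(j : F) - 1) * κ) * f.coeff (j + 1) by simp,
      show ((((0 : ℕ) : F[X]) - (j : F[X])) * C μ * f.coeff j) =
        C (-(j : F) * μ) * f.coeff j by simp, coeff_C_mul, coeff_C_mul, hj, hj]
    push_cast
    ring

theorem riccati_eq_add (e κ μ : F) (D : ℕ) (f : F[X][X]) :
    riccati e κ μ D f = riccati e κ μ 0 f + (D : F[X][X]) * (C (C κ) - C (C μ) * X) * f := by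
  simp only [riccati_apply]
  push_cast
  ring

theorem natDegree_swap_eq_of_riccati (p : ℕ) [CharP F p] {e κ μ : F} {a b : F[X][X]}
    (ha : a ≠ 0) (hb : b ≠ 0) (haD : a.natDegree < p) (hbD : b.natDegree < p)
    (haA : ∀ j, (a.coeff j).natDegree < p) (hbA : ∀ j, (b.coeff j).natDegree < p)
    (h : a * riccati e κ μ 0 b = b * riccati e κ μ 0 a) :
    (Bivariate.swap a).natDegree = (Bivariate.swap b).natDegree ∧
    (Bivariate.swap a).leadingCoeff.natDegree = (Bivariate.swap b).leadingCoeff.natDegree := by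
  have lc_ne {f : F[X][X]} (hf : f ≠ 0) : (Bivariate.swap f).leadingCoeff ≠ 0 :=
    leadingCoeff_ne_zero.2 ((map_ne_zero_iff _ Bivariate.swap.injective).2 hf)
  have hlt {f : F[X][X]} (hp : 0 < p) (hf : ∀ j, (f.coeff j).natDegree < p) :
      (Bivariate.swap f).natDegree < p :=
    (natDegree_swap_le (d := p - 1) fun j => by have := hf j; omega).trans_lt (by omega)
  have hdeg (f : F[X][X]) : (Bivariate.swap (riccati e κ μ 0 f)).natDegree ≤
      (Bivariate.swap f).natDegree + 1 :=
    natDegree_swap_le (natDegree_coeff_riccati_le _ _ _ _ (natDegree_coeff_le_swap f))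
  have hc (f g : F[X][X]) : (Bivariate.swap (f * riccati e κ μ 0 g)).coeff
      ((Bivariate.swap f).natDegree + ((Bivariate.swap g).natDegree + 1)) =
      (Bivariate.swap f).leadingCoeff * (-C ((Bivariate.swap g).natDegree : F) *
        (Bivariate.swap g).leadingCoeff + derivative (Bivariate.swap g).leadingCoeff) := by
    rw [map_mul, coeff_mul_add_eq_of_natDegree_le le_rfl (hdeg g), coeff_swap_riccati le_rfl]
    rfl
  have h1 := hc a b
  rw [h, ← add_assoc, add_comm (natDegree _), add_assoc, hc b a] at h1
  have hp : 0 < p := by omega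
  obtain ⟨h2, h3⟩ := natDegree_eq_of_wronskian p (lc_ne ha) (lc_ne hb)
    ((natDegree_coeff_swap_le _ _).trans_lt haD) ((natDegree_coeff_swap_le _ _).trans_lt hbD)
    h1.symm
  exact ⟨CharP.natCast_injOn_Iio F p (hlt hp haA) (hlt hp hbA) h2, h3⟩

theorem exists_eq_C_mul_of_riccati (p : ℕ) [CharP F p] {e κ μ : F} {a b : F[X][X]}
    (ha : a ≠ 0) (haD : a.natDegree < p) (hbD : b.natDegree < p)
    (haA : ∀ j, (a.coeff j).natDegree < p) (hbA : ∀ j, (b.coeff j).natDegree < p)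
    (h : a * riccati e κ μ 0 b = b * riccati e κ μ 0 a) : ∃ c : F, b = c • a := by
  rcases eq_or_ne b 0 with rfl | hb
  · exact ⟨0, by simp⟩
  obtain ⟨h1, h2⟩ := natDegree_swap_eq_of_riccati p ha hb haD hbD haA hbA h
  set u := (Bivariate.swap a).leadingCoeff with hu
  set v := (Bivariate.swap b).leadingCoeff with hv
  have lc_ne {f : F[X][X]} (hf : f ≠ 0) : (Bivariate.swap f).leadingCoeff ≠ 0 :=
    leadingCoeff_ne_zero.2 ((map_ne_zero_iff _ Bivariate.swap.injective).2 hf)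
  have ha0 : u.leadingCoeff ≠ 0 := leadingCoeff_ne_zero.2 (lc_ne ha)
  refine ⟨v.leadingCoeff / u.leadingCoeff, ?_⟩
  set c := v.leadingCoeff / u.leadingCoeff with hc
  by_contra hne
  have hne' := sub_ne_zero.2 hne
  have h3 : a * riccati e κ μ 0 (b - c • a) = (b - c • a) * riccati e κ μ 0 a := by
    rw [map_sub, map_smul, mul_sub, h, sub_mul, mul_smul_comm, smul_mul_assoc]
  have hp : 0 < p := by omega
  obtain ⟨h4, h5⟩ := natDegree_swap_eq_of_riccati p ha hne' haD
    ((natDegree_sub_le _ _).trans_lt (max_lt hbD ((natDegree_smul_le _ _).trans_lt haD))) haA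
    (fun j => by
      rw [coeff_sub, coeff_smul]
      exact (natDegree_sub_le _ _).trans_lt
        (max_lt (hbA j) ((natDegree_smul_le _ _).trans_lt (haA j)))) h3
  have h6 : (Bivariate.swap (b - c • a)).leadingCoeff = v - C c * u := by
    rw [leadingCoeff, ← h4, map_sub, map_smul, coeff_sub, coeff_smul, smul_eq_C_mul]
    rw [h1]
    congr 2
    rw [← h1]
    rfl
  have h7 := lc_ne hne'
  rw [← hu, h6] at h5
  rw [h6] at h7
  have h8 : (v - C c * u).degree < v.degree := by
    refine degree_sub_lt_left ?_ (lc_ne hb) ?_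
    · rw [degree_C_mul, degree_eq_natDegree (lc_ne hb), degree_eq_natDegree (lc_ne ha), h2]
      exact div_ne_zero (leadingCoeff_ne_zero.2 (lc_ne hb)) ha0
    · rw [leadingCoeff_mul, leadingCoeff_C, hc, div_mul_cancel₀ _ ha0]
  have := natDegree_lt_natDegree h7 h8
  omega

/-- The polynomial in two variables with prescribed coefficients. -/
def formOfCoeffs (D A : ℕ) : (Fin (D + 1) → degreeLT F (A + 1)) →ₗ[F] F[X][X] :=
  ∑ j : Fin (D + 1), ((monomial (j : ℕ) : F[X] →ₗ[F[X]] F[X][X]).restrictScalars F) ∘ₗ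
    (degreeLT F (A + 1)).subtype ∘ₗ LinearMap.proj j

theorem formOfCoeffs_apply (D A : ℕ) (v : Fin (D + 1) → degreeLT F (A + 1)) :
    formOfCoeffs D A v = ∑ j : Fin (D + 1), monomial (j : ℕ) (v j : F[X]) := by
  simp [formOfCoeffs, LinearMap.sum_apply]

theorem coeff_formOfCoeffs {D A : ℕ} (v : Fin (D + 1) → degreeLT F (A + 1)) (j : Fin (D + 1)) :
    (formOfCoeffs D A v).coeff j = v j := by
  rw [formOfCoeffs_apply, finsetSum_coeff, Finset.sum_eq_single j]
  · simp
  · intro i _ hi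
    rw [coeff_monomial, if_neg (fun h => hi (Fin.ext h))]
  · simp

theorem natDegree_formOfCoeffs_le {D A : ℕ} (v : Fin (D + 1) → degreeLT F (A + 1)) :
    (formOfCoeffs D A v).natDegree ≤ D := by
  rw [formOfCoeffs_apply]
  exact natDegree_sum_le_of_forall_le _ _ fun j _ =>
    (natDegree_monomial_le _).trans (by omega)

theorem natDegree_coeff_formOfCoeffs_le {D A : ℕ} (v : Fin (D + 1) → degreeLT F (A + 1)) (j : ℕ) :
    ((formOfCoeffs D A v).coeff j).natDegree ≤ A := by
  rcases Nat.lt_or_ge D j with h | h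
  · rw [coeff_eq_zero_of_natDegree_lt ((natDegree_formOfCoeffs_le v).trans_lt h)]
    simp
  · have := coeff_formOfCoeffs v ⟨j, by omega⟩
    rw [show (formOfCoeffs D A v).coeff j = _ from this]
    have h2 := mem_degreeLT.1 (v ⟨j, by omega⟩).2
    rw [natDegree_le_iff_coeff_eq_zero]
    intro n hn
    exact coeff_eq_zero_of_degree_lt (h2.trans_le (by exact_mod_cast hn))

theorem natDegree_coeff_iterate_riccati_le (e κ μ : F) (D : ℕ) {f : F[X][X]} {d : ℕ}
    (hf : ∀ j, (f.coeff j).natDegree ≤ d) (n j : ℕ) :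
    (((riccati e κ μ D ^ n) f).coeff j).natDegree ≤ d + n := by
  induction n generalizing j with
  | zero => simpa using hf j
  | succ n ih =>
    rw [pow_succ', Module.End.mul_apply]
    exact natDegree_coeff_riccati_le e κ μ D ih j

theorem natDegree_iterate_riccati_le (e κ μ : F) {D : ℕ} {f : F[X][X]} (hf : f.natDegree ≤ D)
    (n : ℕ) : ((riccati e κ μ D ^ n) f).natDegree ≤ D := by
  induction n with
  | zero => simpa using hf
  | succ n ih =>
    rw [pow_succ', Module.End.mul_apply]
    exact natDegree_riccati_le e κ μ ih

/-- Siegel's lemma: there is an auxiliary pair of forms `(a, b)` such that `W * a + b` vanishes to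
order `M` along `W = X`. -/
theorem exists_auxiliary_forms (e κ μ : F) {D A M : ℕ}
    (hdim : ∑ n : Fin M, (A + 2 + n) < 2 * ((D + 1) * (A + 1))) :
    ∃ a b : F[X][X], (a ≠ 0 ∨ b ≠ 0) ∧ a.natDegree ≤ D ∧ b.natDegree ≤ D ∧
      (∀ j, (a.coeff j).natDegree ≤ A) ∧ (∀ j, (b.coeff j).natDegree ≤ A) ∧
      ∀ n < M, X * ((riccati e κ μ D ^ n) a).coeff 0 + ((riccati e κ μ D ^ n) b).coeff 0 = 0 := by
  have hfr (k : ℕ) : Module.finrank F (degreeLT F k) = k := by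
    rw [(degreeLTEquiv F k).finrank_eq, Module.finrank_fin_fun]
  let V := Fin (D + 1) → degreeLT F (A + 1)
  let T (n : ℕ) : V →ₗ[F] F[X] := ((lcoeff F[X] 0).restrictScalars F) ∘ₗ
    (riccati e κ μ D ^ n) ∘ₗ formOfCoeffs D A
  let S (n : ℕ) : V × V →ₗ[F] F[X] :=
    LinearMap.mulLeft F X ∘ₗ T n ∘ₗ LinearMap.fst F V V + T n ∘ₗ LinearMap.snd F V V
  have hT (n : ℕ) (v : V) : T n v = ((riccati e κ μ D ^ n) (formOfCoeffs D A v)).coeff 0 := rfl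
  have hS (n : ℕ) (v : V × V) : S n v = X * T n v.1 + T n v.2 := rfl
  have hTd (n : ℕ) (v : V) : (T n v).natDegree ≤ A + n := by
    rw [hT]
    exact natDegree_coeff_iterate_riccati_le e κ μ D (natDegree_coeff_formOfCoeffs_le v) n 0
  have hSd (n : ℕ) (v : V × V) : S n v ∈ degreeLT F (A + 2 + n) := by
    rw [mem_degreeLT, hS]
    refine (degree_le_natDegree).trans_lt (Nat.cast_lt.2 ?_)
    refine (natDegree_add_le_of_degree_le (n := A + n + 1) ?_ ?_).trans_lt (by omega)
    · refine natDegree_mul_le.trans ?_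
      have := hTd n v.1
      rw [natDegree_X]
      omega
    · exact (hTd n v.2).trans (by omega)
  let Φ : V × V →ₗ[F] ((n : Fin M) → degreeLT F (A + 2 + n)) :=
    LinearMap.pi fun n => (S n).codRestrict _ (hSd n)
  have hker : LinearMap.ker Φ ≠ ⊥ := by
    refine LinearMap.ker_ne_bot_of_finrank_lt ?_
    rw [Module.finrank_pi_fintype, Module.finrank_prod, Module.finrank_pi_fintype]
    simp only [hfr, Finset.sum_const, Finset.card_univ, Fintype.card_fin, smul_eq_mul]
    omega
  obtain ⟨v, hv, hv0⟩ := Submodule.exists_mem_ne_zero_of_ne_bot hker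
  refine ⟨formOfCoeffs D A v.1, formOfCoeffs D A v.2, ?_, natDegree_formOfCoeffs_le _,
    natDegree_formOfCoeffs_le _, natDegree_coeff_formOfCoeffs_le _,
    natDegree_coeff_formOfCoeffs_le _, fun n hn => ?_⟩
  · by_contra! h
    refine hv0 (Prod.ext (funext fun j => Subtype.ext ?_) (funext fun j => Subtype.ext ?_))
    · rw [← coeff_formOfCoeffs, h.1]; simp; rfl
    · rw [← coeff_formOfCoeffs, h.2]; simp; rfl
  · have := congrArg Subtype.val (congrFun (LinearMap.mem_ker.1 hv) ⟨n, hn⟩)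
    exact this

theorem twistedDeriv_X_pow_char_mul_add (p : ℕ) [CharP F p] (e : F) (w : ℕ) (f g : F[X]) :
    twistedDeriv e w (X ^ p * f + g) = X ^ p * twistedDeriv e w f + twistedDeriv e w g := by
  simp only [twistedDeriv, derivative_add, derivative_mul, derivative_X_pow, CharP.cast_eq_zero,
    C_0]
  ring

theorem natDegree_homEval_le {P Z : F[X]} {m D A : ℕ} (hP : P.natDegree ≤ m) (hZ : Z.natDegree ≤ m)
    {f : F[X][X]} (hf : f.natDegree ≤ D) (hc : ∀ j, (f.coeff j).natDegree ≤ A) :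
    (homEval P Z D f).natDegree ≤ A + D * m := by
  rw [f.as_sum_range' (D + 1) (by omega)]
  have h : homEval P Z D (∑ j ∈ Finset.range (D + 1), monomial j (f.coeff j)) =
      ∑ j ∈ Finset.range (D + 1), homEval P Z D (monomial j (f.coeff j)) := by
    simp [homEval, homogenize_finsetSum]
  rw [h]
  refine natDegree_sum_le_of_forall_le _ _ fun j hj => ?_
  have hj : j ≤ D := by simpa [Nat.lt_succ_iff] using hj
  rw [homEval_monomial P Z hj]
  obtain ⟨k, rfl⟩ := Nat.exists_eq_add_of_le hj
  rw [Nat.add_sub_cancel_left, add_mul, ← add_assoc]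
  refine natDegree_mul_le_of_le (natDegree_mul_le_of_le (hc j) ?_) ?_
  · exact natDegree_pow_le_of_le _ hP
  · exact natDegree_pow_le_of_le _ hZ

/-- Stepanov's method: a solution `P` of a hypergeometric equation whose degree is large both
absolutely and in comparison to the characteristic does not split completely. -/
theorem not_dvd_X_pow_char_sub_X (p : ℕ) [CharP F p] {e κ μ : F} {m : ℕ} {P Z : F[X]}
    (hP : X * derivative P = (m : F[X]) * P - Z)
    (hZ : twistedDeriv e m Z = C κ * Z - C μ * P)
    (hPm : P.natDegree = m) (hZm : Z.natDegree ≤ m)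
    (hcop : IsCoprime P ((X - C e) * (X * derivative P)))
    {D A M : ℕ} (hdim : ∑ n : Fin M, (A + 2 + n) < 2 * ((D + 1) * (A + 1)))
    (hM : M ≤ p) (hD : D < p) (hAm : 2 * A + 1 < m) (hmp : m < p)
    (hdeg : p + A + D * m < M * m) : ¬ P ∣ X ^ p - X := by
  intro hdvd
  obtain ⟨a, b, hab, haD, hbD, haA, hbA, hvan⟩ := exists_auxiliary_forms e κ μ hdim
  have hPZ : IsCoprime P Z := by
    have h1 : IsCoprime P (X * derivative P) := hcop.of_mul_right_right
    rw [hP] at h1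
    have := (IsCoprime.add_mul_left_right_iff (z := -(m : F[X]))).2 h1
    rw [show (m : F[X]) * P - Z + P * -(m : F[X]) = -Z by ring] at this
    exact (IsCoprime.neg_right_iff _ _).1 this
  have hiter (n : ℕ) : (twistedDeriv e (m * D))^[n]
      (X ^ p * homEval P Z D a + homEval P Z D b) =
      X ^ p * homEval P Z D ((riccati e κ μ D ^ n) a) +
        homEval P Z D ((riccati e κ μ D ^ n) b) := by
    induction n with
    | zero => simp
    | succ n ih =>
      rw [Function.iterate_succ_apply', ih, twistedDeriv_X_pow_char_mul_add, pow_succ',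
        Module.End.mul_apply, Module.End.mul_apply,
        homEval_riccati hP hZ (natDegree_iterate_riccati_le e κ μ haD n),
        homEval_riccati hP hZ (natDegree_iterate_riccati_le e κ μ hbD n)]
  have hPM : P ^ M ∣ X ^ p * homEval P Z D a + homEval P Z D b := by
    refine pow_dvd_of_dvd_iterate_twistedDeriv p hcop (m * D) hM fun n hn => ?_
    rw [hiter]
    have h1 := dvd_homEval_sub P Z (natDegree_iterate_riccati_le e κ μ haD n)
    have h2 := dvd_homEval_sub P Z (natDegree_iterate_riccati_le e κ μ hbD n)
    have h3 := hvan n hn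
    convert dvd_add (dvd_add (h1.mul_left (X ^ p)) h2)
      (hdvd.mul_right (((riccati e κ μ D ^ n) a).coeff 0 * Z ^ D)) using 1
    linear_combination Z ^ D * h3
  have hzero : X ^ p * homEval P Z D a + homEval P Z D b = 0 := by
    refine eq_zero_of_dvd_of_natDegree_lt hPM ?_
    rw [natDegree_pow, hPm]
    refine lt_of_le_of_lt ?_ hdeg
    rw [add_assoc]
    refine natDegree_add_le_of_degree_le (natDegree_mul_le_of_le (natDegree_X_pow_le p)
      (natDegree_homEval_le hPm.le hZm haD haA)) ?_
    exact (natDegree_homEval_le hPm.le hZm hbD hbA).trans (by omega)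
  have hzero' := hiter 1
  rw [hzero] at hzero'
  simp only [Function.iterate_one, pow_one] at hzero'
  have htw : twistedDeriv e (m * D) 0 = 0 := by simp [twistedDeriv]
  rw [htw] at hzero'
  have hW : a * riccati e κ μ D b - b * riccati e κ μ D a = 0 := by
    refine eq_zero_of_homEval_eq_zero hPZ (D := D + D) ?_ (fun j => ?_) ?_
    · exact (natDegree_sub_le_of_le (natDegree_mul_le_of_le haD (natDegree_riccati_le e κ μ hbD))
        (natDegree_mul_le_of_le hbD (natDegree_riccati_le e κ μ haD))).trans_eq (max_self _)
    · rw [coeff_sub, hPm]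
      refine lt_of_le_of_lt ((natDegree_sub_le_of_le
        (natDegree_coeff_mul_le haA (natDegree_coeff_riccati_le e κ μ D hbA) j)
        (natDegree_coeff_mul_le hbA (natDegree_coeff_riccati_le e κ μ D haA) j)).trans_eq
        (max_self _)) (by omega)
    · rw [homEval_sub, homEval_mul P Z haD (natDegree_riccati_le e κ μ hbD),
        homEval_mul P Z hbD (natDegree_riccati_le e κ μ haD)]
      linear_combination -homEval P Z D (riccati e κ μ D a) * hzero - homEval P Z D a * hzero'
  have hsmall {f : F[X][X]} (hf : f.natDegree ≤ D) (hc : ∀ j, (f.coeff j).natDegree ≤ A)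
      (h0 : homEval P Z D f = 0) : f = 0 :=
    eq_zero_of_homEval_eq_zero hPZ hf (fun j => (hc j).trans_lt (by omega)) h0
  have ha : a ≠ 0 := by
    rintro rfl
    rw [homEval_zero, mul_zero, zero_add] at hzero
    exact hab.elim (fun h => h rfl) fun h => h (hsmall hbD hbA hzero)
  obtain ⟨c, rfl⟩ : ∃ c : F, b = c • a := by
    refine exists_eq_C_mul_of_riccati p (e := e) (κ := κ) (μ := μ) ha (by omega) (by omega)
      (fun j => (haA j).trans_lt (by omega)) (fun j => (hbA j).trans_lt (by omega)) ?_
    rw [riccati_eq_add, riccati_eq_add _ _ _ _ a] at hW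
    linear_combination hW
  have hc : homEval P Z D (c • a) = C c * homEval P Z D a := by
    rw [← homEval_C_mul, ← smul_eq_C_mul, ← algebraMap_eq, algebraMap_smul]
  rw [hc, ← add_mul, mul_eq_zero] at hzero
  exact hzero.elim (X_pow_add_C_ne_zero (by omega) c) fun h => ha (hsmall haD haA h)

/-- The coefficients of the hypergeometric series `₂F₁(-m, β; 1; e * t)`. -/
def hypCoeff (e β : F) (m n : ℕ) : F :=
  (ascPochhammer F n).eval (-(m : F)) * (ascPochhammer F n).eval β / (n.factorial : F) ^ 2 * e ^ n

/-- The reversed hypergeometric polynomial `X ^ m * ₂F₁(-m, β; 1; e / X)`. -/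
def hypPoly (e β : F) (m : ℕ) : F[X] :=
  ∑ n ∈ Finset.range (m + 1), C (hypCoeff e β m n) * X ^ (m - n)

/-- The image of `hypPoly` under the derivation `m - X * d/dX`. -/
def hypPolyDeriv (e β : F) (m : ℕ) : F[X] :=
  ∑ n ∈ Finset.range (m + 1), C ((n : F) * hypCoeff e β m n) * X ^ (m - n)

theorem hypCoeff_zero (e β : F) (m : ℕ) : hypCoeff e β m 0 = 1 := by simp [hypCoeff]

theorem hypCoeff_succ (e β : F) (m : ℕ) {n : ℕ} (hn : ((n + 1 : ℕ) : F) ≠ 0) :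
    ((n : F) + 1) ^ 2 * hypCoeff e β m (n + 1) =
      (n - m) * (β + n) * e * hypCoeff e β m n := by
  push_cast at hn
  simp only [hypCoeff, ascPochhammer_succ_eval, Nat.factorial_succ]
  push_cast
  by_cases h : (n.factorial : F) = 0
  · simp [h]
  · field_simp
    ring

theorem hypPoly_eq_X_pow_add (e β : F) (m : ℕ) :
    hypPoly e β m = X ^ m +
      ∑ n ∈ Finset.range m, C (hypCoeff e β m (n + 1)) * X ^ (m - (n + 1)) := by
  rw [hypPoly, Finset.sum_range_succ', hypCoeff_zero]
  simp [add_comm]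

theorem degree_hypPoly_tail_lt (e β : F) (m : ℕ) :
    (∑ n ∈ Finset.range m, C (hypCoeff e β m (n + 1)) * X ^ (m - (n + 1))).degree <
      (m : WithBot ℕ) := by
  refine (degree_sum_le _ _).trans_lt ((Finset.sup_lt_iff (WithBot.bot_lt_coe m)).2 fun n hn => ?_)
  refine (degree_C_mul_X_pow_le _ _).trans_lt ?_
  have := Finset.mem_range.1 hn
  exact Nat.cast_lt.2 (by omega)

theorem monic_hypPoly (e β : F) (m : ℕ) : (hypPoly e β m).Monic := by
  rw [hypPoly_eq_X_pow_add]
  exact monic_X_pow_add (degree_hypPoly_tail_lt e β m)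

theorem natDegree_hypPoly (e β : F) (m : ℕ) : (hypPoly e β m).natDegree = m := by
  rw [hypPoly_eq_X_pow_add, natDegree_add_eq_left_of_degree_lt, natDegree_X_pow]
  rw [degree_X_pow]
  exact degree_hypPoly_tail_lt e β m

theorem natDegree_hypPolyDeriv_le (e β : F) (m : ℕ) : (hypPolyDeriv e β m).natDegree ≤ m :=
  natDegree_sum_le_of_forall_le _ _ fun _ _ => (natDegree_C_mul_X_pow_le _ _).trans (by omega)

theorem X_mul_derivative_sum (c : ℕ → F) (m : ℕ) :
    X * derivative (∑ n ∈ Finset.range (m + 1), C (c n) * X ^ (m - n)) =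
      (m : F[X]) * ∑ n ∈ Finset.range (m + 1), C (c n) * X ^ (m - n) -
      ∑ n ∈ Finset.range (m + 1), C ((n : F) * c n) * X ^ (m - n) := by
  rw [derivative_sum, Finset.mul_sum, Finset.mul_sum, ← Finset.sum_sub_distrib]
  refine Finset.sum_congr rfl fun n hn => ?_
  obtain ⟨k, rfl⟩ := Nat.exists_eq_add_of_le (Nat.lt_succ_iff.1 (Finset.mem_range.1 hn))
  rw [Nat.add_sub_cancel_left]
  cases k with
  | zero => simp
  | succ k =>
    simp
    ring

theorem X_mul_derivative_hypPoly (e β : F) (m : ℕ) :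
    X * derivative (hypPoly e β m) = (m : F[X]) * hypPoly e β m - hypPolyDeriv e β m :=
  X_mul_derivative_sum _ _

theorem twistedDeriv_hypPolyDeriv (e β : F) {m : ℕ} (hm : ∀ n < m, ((n + 1 : ℕ) : F) ≠ 0) :
    twistedDeriv e m (hypPolyDeriv e β m) =
      C (e * (β - m)) * hypPolyDeriv e β m - C (e * m * β) * hypPoly e β m := by
  have h1 : (m : F[X]) * hypPolyDeriv e β m - X * derivative (hypPolyDeriv e β m) =
      ∑ n ∈ Finset.range (m + 1), C ((n : F) * (n * hypCoeff e β m n)) * X ^ (m - n) := by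
    rw [hypPolyDeriv, X_mul_derivative_sum]
    ring
  have h2 : X * ∑ n ∈ Finset.range (m + 1), C ((n : F) * (n * hypCoeff e β m n)) * X ^ (m - n) =
      ∑ n ∈ Finset.range (m + 1),
        C ((n - m) * (β + n) * e * hypCoeff e β m n) * X ^ (m - n) := by
    rw [Finset.sum_range_succ', Finset.sum_range_succ _ m, mul_add, Finset.mul_sum]
    simp only [sub_self, zero_mul, Nat.cast_zero, C_0, mul_zero, add_zero]
    refine Finset.sum_congr rfl fun n hn => ?_
    have hn := Finset.mem_range.1 hn
    rw [← hypCoeff_succ e β m (hm n hn), show m - n = m - (n + 1) + 1 by omega, pow_succ]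
    push_cast
    simp only [C_mul, C_add, C_pow]
    ring
  rw [twistedDeriv, h1, sub_mul, h2, hypPolyDeriv, hypPoly, Finset.mul_sum, Finset.mul_sum,
    Finset.mul_sum, ← Finset.sum_sub_distrib, ← Finset.sum_sub_distrib]
  refine Finset.sum_congr rfl fun n _ => ?_
  simp only [C_mul, C_sub, C_add]
  ring

theorem isCoprime_of_separable {e κ μ : F} {m : ℕ} {P Z : F[X]}
    (hP : X * derivative P = (m : F[X]) * P - Z) (hZ : twistedDeriv e m Z = C κ * Z - C μ * P)
    (he : e ≠ 0) (hκ : κ ≠ 0) (hμ : e * (m - 1) ^ 2 + κ * (m - 1) - μ ≠ 0)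
    (hsep : P.Separable) : IsCoprime P ((X - C e) * (X * derivative P)) := by
  have hroot {x : F} (h0 : P.eval x = 0) (h1 : (derivative P).eval x = 0) : False := by
    obtain ⟨a, b, hab⟩ := hsep
    simpa [h0, h1] using congrArg (eval x) hab
  have hcop {x : F} (hx : P.eval x ≠ 0) : IsCoprime P (X - C x) := by
    refine ((irreducible_X_sub_C x).coprime_iff_not_dvd.2 ?_).symm
    rwa [dvd_iff_isRoot]
  rw [twistedDeriv] at hZ
  refine (hcop fun h0 => hroot h0 ?_).mul_right (IsCoprime.mul_right ?_ hsep)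
  · have h1 := congrArg (eval e) hP
    have h2 := congrArg (eval e) hZ
    simp [h0, hκ] at h1 h2
    simpa [h2, he] using h1
  · rw [← sub_zero X, ← C_0]
    refine hcop fun h0 => hroot h0 ?_
    have h1 := congrArg (eval 0) hP
    have h2 := congrArg (fun f => eval 0 (derivative f)) hP
    have h3 := congrArg (fun f => eval 0 (derivative f)) hZ
    have hZ0 : Z.eval 0 = 0 := by simpa [h0] using h1
    simp [hZ0] at h2 h3
    refine (mul_eq_zero.1 ?_).resolve_left hμ
    linear_combination -(e * (m - 1) + κ) * h2 - h3

theorem dvd_X_pow_char_sub_X_of_natDegree_eq {p : ℕ} [Fact p.Prime] {f : (ZMod p)[X]}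
    (hf : f ≠ 0) (h : f.natDegree = f.roots.toFinset.card) : f ∣ X ^ p - X := by
  have h1 := f.roots.toFinset_card_le
  have h2 := f.card_roots'
  have hs : f.Splits := splits_iff_card_roots.2 (by omega)
  have hnd : f.roots.Nodup := Multiset.toFinset_card_eq_card_iff_nodup.1 (by omega)
  refine hs.dvd_of_roots_le_roots hf ?_
  have h3 := FiniteField.roots_X_pow_card_sub_X (ZMod p)
  rw [ZMod.card] at h3
  rw [h3, Multiset.le_iff_subset hnd]
  exact fun x _ => Finset.mem_univ x

theorem separable_X_pow_char_sub_X (p : ℕ) [Fact p.Prime] :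
    (X ^ p - X : (ZMod p)[X]).Separable := by
  refine ⟨0, -1, ?_⟩
  simp [derivative_X_pow]

/-- The coefficient and the remainder modulo `X ^ 2 - u * X - w` of the partial sums of a scalar
multiple of `hypPoly`. -/
def hypRemainder (e k b u w : ℕ) : ℕ → ℕ × ℕ × ℕ
  | 0 => (1, 0, 1)
  | n + 1 =>
    let r := hypRemainder e k b u w n
    let a := r.1 * ((k + n) * (b + 8 * n) * e)
    let g := 8 * (n + 1) ^ 2
    (a, g * (r.2.1 * u + r.2.2), g * (r.2.1 * w) + a)

theorem cast_hypRemainder {e k b m : ℕ} {β : F} (hβ : 8 * β = b) (hk : (k : F) = -m) (u w : ℕ)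
    {n : ℕ} (hn : (n.factorial : F) ≠ 0) :
    ((hypRemainder e k b u w n).1 : F) =
      8 ^ n * (n.factorial : F) ^ 2 * hypCoeff (e : F) β m n := by
  induction n with
  | zero => simp [hypRemainder, hypCoeff]
  | succ n ih =>
    rw [Nat.factorial_succ, Nat.cast_mul] at hn ⊢
    have h := hypCoeff_succ (e : F) β m (left_ne_zero_of_mul hn)
    simp only [hypRemainder]
    push_cast
    rw [ih (right_ne_zero_of_mul hn), ← hβ, hk]
    linear_combination -(8 ^ (n + 1) * (n.factorial : F) ^ 2) * h

theorem dvd_hypPoly_sub_hypRemainder {e k b m : ℕ} {β : F} (hβ : 8 * β = b) (hk : (k : F) = -m)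
    (u w : ℕ) {n : ℕ} (hn : (n.factorial : F) ≠ 0) :
    X ^ 2 - (u : F[X]) * X - (w : F[X]) ∣
      C (8 ^ n * (n.factorial : F) ^ 2) *
        (∑ i ∈ Finset.range (n + 1), C (hypCoeff (e : F) β m i) * X ^ (n - i)) -
      (((hypRemainder e k b u w n).2.1 : F[X]) * X + ((hypRemainder e k b u w n).2.2 : F[X])) := by
  induction n with
  | zero => simp [hypRemainder, hypCoeff]
  | succ n ih =>
    have hn' := hn
    rw [Nat.factorial_succ, Nat.cast_mul] at hn'
    have h1 : ∑ i ∈ Finset.range (n + 1), C (hypCoeff (e : F) β m i) * X ^ (n + 1 - i) =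
        X * ∑ i ∈ Finset.range (n + 1), C (hypCoeff (e : F) β m i) * X ^ (n - i) := by
      rw [Finset.mul_sum]
      refine Finset.sum_congr rfl fun i hi => ?_
      rw [Nat.sub_add_comm (Nat.lt_succ_iff.1 (Finset.mem_range.1 hi)), pow_succ]
      ring
    have h2 : ((hypRemainder e k b u w (n + 1)).1 : F[X]) =
        C (8 ^ (n + 1) * ((n + 1).factorial : F) ^ 2) * C (hypCoeff (e : F) β m (n + 1)) := by
      rw [← C_mul, ← cast_hypRemainder hβ hk u w hn, C_eq_natCast]
    rw [Finset.sum_range_succ, h1, Nat.sub_self, pow_zero, mul_one, mul_add, ← h2]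
    have h3 := (ih (right_ne_zero_of_mul hn')).mul_left (C (8 * ((n : F) + 1) ^ 2) * X)
    have h4 := h3.add (dvd_mul_left _
      (((8 * (n + 1) ^ 2 * (hypRemainder e k b u w n).2.1 : ℕ)) : F[X]))
    convert h4 using 1
    rw [Nat.factorial_succ]
    generalize (∑ i ∈ Finset.range (n + 1), C (hypCoeff (e : F) β m i) * X ^ (n - i)) = S
    simp only [hypRemainder, map_mul, map_pow, map_ofNat, Nat.cast_mul, Nat.cast_add, Nat.cast_pow,
      Nat.cast_ofNat, Nat.cast_one, map_natCast, map_add, map_one]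
    ring

end Forms

theorem eps_eq {p : ℕ} [Fact p.Prime] (hp : 5 ≤ p) : eps p = p % 4 / 2 := by
  have hodd : p % 2 = 1 := (Fact.out : p.Prime).eq_two_or_odd.resolve_left (by omega)
  rw [eps, legendreSym.at_neg_one (by omega), ZMod.χ₄_nat_eq_if_mod_four]
  rcases (by omega : p % 4 = 1 ∨ p % 4 = 3) with h | h <;> simp [h, hodd]

theorem nu_eq {p : ℕ} [Fact p.Prime] (hp : 5 ≤ p) : nu p = p % 8 / 4 := by
  have hodd : p % 2 = 1 := (Fact.out : p.Prime).eq_two_or_odd.resolve_left (by omega)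
  rw [nu, legendreSym.at_neg_two (by omega), ZMod.χ₈'_nat_eq_if_mod_eight]
  rcases (by omega : p % 8 = 1 ∨ p % 8 = 3 ∨ p % 8 = 5 ∨ p % 8 = 7) with h | h | h | h <;>
    simp [h, hodd]

/-- The parameter `β₂ = 3/8 - (ε - 2ν)/4`. -/
def betaTwo (p : ℕ) [Fact p.Prime] : ZMod p :=
  (3 : ZMod p) / 8 - ((((eps p : ℤ) - 2 * (nu p : ℤ)) : ℤ) : ZMod p) / 4

theorem natCast_ne_zero_of_coprime {p n : ℕ} [Fact p.Prime] (h : n.Coprime p) :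
    (n : ZMod p) ≠ 0 := by
  rw [Ne, ZMod.natCast_eq_zero_iff, ← (Fact.out : p.Prime).coprime_iff_not_dvd]
  exact h.symm

/-- The numerator of `β₂`. -/
def betaNum (p : ℕ) : ℕ := 3 + 4 * (p % 8 / 4) - 2 * (p % 4 / 2)

theorem eight_mul_betaTwo {p : ℕ} [Fact p.Prime] (hp : 5 ≤ p) :
    8 * betaTwo p = (betaNum p : ZMod p) := by
  have h2 : (2 : ZMod p) ≠ 0 := mod_cast natCast_ne_zero_of_coprime
    ((Nat.coprime_primes Nat.prime_two Fact.out).2 (by omega : 2 ≠ p))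
  have h8 : (8 : ZMod p) ≠ 0 := by
    rw [show (8 : ZMod p) = 2 ^ 3 by norm_num]
    exact pow_ne_zero _ h2
  have h4 : (4 : ZMod p) ≠ 0 := by
    rw [show (4 : ZMod p) = 2 ^ 2 by norm_num]
    exact pow_ne_zero _ h2
  rw [betaTwo, eps_eq hp, nu_eq hp, betaNum, Nat.cast_sub (by omega)]
  generalize p % 8 / 4 = v
  generalize p % 4 / 2 = e
  push_cast
  field_simp
  ring

theorem ss2Star_eq (p : ℕ) [Fact p.Prime] :
    ss2Star p = (X - C 256) ^ nu p * (X ^ eps p * hypPoly 256 (betaTwo p) (p / 8)) := by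
  rw [ss2Star, hypPoly]
  congr 1
  rw [Finset.mul_sum]
  refine Finset.sum_congr rfl fun n hn => ?_
  have := Finset.mem_range.1 hn
  rw [mul_left_comm, ← pow_add, show eps p + (p / 8 - n) = p / 8 + eps p - n by omega]
  rfl

theorem natDegree_ss2Star (p : ℕ) [Fact p.Prime] :
    (ss2Star p).natDegree = nu p + (eps p + p / 8) := by
  have h := monic_hypPoly 256 (betaTwo p) (p / 8)
  rw [ss2Star_eq, ((monic_X_sub_C (256 : ZMod p)).pow (nu p)).natDegree_mul
    ((monic_X_pow _).mul h),
    (monic_X_pow (R := ZMod p) (eps p)).natDegree_mul h, natDegree_hypPoly, natDegree_X_pow,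
    natDegree_pow, natDegree_X_sub_C, mul_one]

theorem ss2Star_ne_zero (p : ℕ) [Fact p.Prime] : ss2Star p ≠ 0 := by
  rw [ss2Star_eq]
  exact (((monic_X_sub_C _).pow _).mul ((monic_X_pow _).mul (monic_hypPoly _ _ _))).ne_zero

theorem hypPoly_dvd_X_pow_char_sub_X {p : ℕ} [Fact p.Prime]
    (h : (ss2Star p).natDegree = L2Star p) : hypPoly 256 (betaTwo p) (p / 8) ∣ X ^ p - X :=
  (((dvd_mul_left _ _).mul_left _).trans (ss2Star_eq p).symm.dvd).trans
    (dvd_X_pow_char_sub_X_of_natDegree_eq (ss2Star_ne_zero p) h)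

theorem factorial_ne_zero_of_lt {p n : ℕ} [Fact p.Prime] (h : n < p) :
    (n.factorial : ZMod p) ≠ 0 := by
  rw [Ne, ZMod.natCast_eq_zero_iff, (Fact.out : p.Prime).dvd_factorial]
  omega

theorem natDegree_ss2Star_ne_of_le {p : ℕ} [Fact p.Prime] (hp : 547 ≤ p) :
    (ss2Star p).natDegree ≠ L2Star p := by
  intro h
  have hodd : p % 2 = 1 := (Fact.out : p.Prime).eq_two_or_odd.resolve_left (by omega)
  have hdvd := hypPoly_dvd_X_pow_char_sub_X h
  have hne {n : ℕ} (hn : 0 < n) (hnp : n < p) : (n : ZMod p) ≠ 0 :=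
    natCast_ne_zero_of_coprime (Nat.coprime_of_lt_prime hn.ne' hnp Fact.out).symm
  have hZ := twistedDeriv_hypPolyDeriv (256 : ZMod p) (betaTwo p) (m := p / 8)
    fun n hn => hne (by omega) (by omega)
  have h256 : (256 : ZMod p) ≠ 0 := mod_cast hne (n := 256) (by omega) (by omega)
  have hβ := eight_mul_betaTwo (p := p) (by omega)
  have hm : 8 * ((p / 8 : ℕ) : ZMod p) = -((p % 8 : ℕ) : ZMod p) := by
    have : ((8 * (p / 8) + p % 8 : ℕ) : ZMod p) = 0 := by
      rw [Nat.div_add_mod, CharP.cast_eq_zero]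
    push_cast at this ⊢
    linear_combination this
  refine not_dvd_X_pow_char_sub_X p (X_mul_derivative_hypPoly _ _ _) hZ (natDegree_hypPoly _ _ _)
    (natDegree_hypPolyDeriv_le _ _ _)
    (isCoprime_of_separable (X_mul_derivative_hypPoly _ _ _) hZ h256 (mul_ne_zero h256 ?_) ?_
      ((separable_X_pow_char_sub_X p).of_dvd hdvd)) (D := 22) (A := 33) (M := 31)
    (by decide) (by omega) (by omega) (by omega) (by omega) (by omega) hdvd
  · intro h0
    refine hne (n := betaNum p + p % 8) (by omega) (by rw [betaNum]; omega) ?_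
    push_cast
    linear_combination -hβ + hm + 8 * h0
  · intro h0
    have h1 := (mul_eq_zero.1 (show (256 : ZMod p) * (1 - (p / 8 : ℕ) - betaTwo p) = 0 by
      linear_combination h0)).resolve_left h256
    refine hne (n := 8 + p % 8 - betaNum p) (by rw [betaNum]; omega) (by omega) ?_
    rw [Nat.cast_sub (by rw [betaNum]; omega)]
    push_cast
    linear_combination 8 * h1 + hm + hβ

/-- The remainder of `hypRemainder` for the parameters of `ss2Star p`. -/
def ss2StarRemainder (p u w : ℕ) : ℕ × ℕ :=
  (hypRemainder 256 (p - p / 8) (betaNum p) u w (p / 8)).2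

theorem exists_dvd_mul_hypPoly_sub {p : ℕ} [Fact p.Prime] (hp : 5 ≤ p) (u w : ℕ) :
    ∃ c : ZMod p, c ≠ 0 ∧ X ^ 2 - (u : (ZMod p)[X]) * X - (w : (ZMod p)[X]) ∣
      C c * hypPoly 256 (betaTwo p) (p / 8) -
      (((ss2StarRemainder p u w).1 : (ZMod p)[X]) * X +
        ((ss2StarRemainder p u w).2 : (ZMod p)[X])) := by
  have hk : ((p - p / 8 : ℕ) : ZMod p) = -((p / 8 : ℕ) : ZMod p) := by
    rw [Nat.cast_sub (by omega), CharP.cast_eq_zero, zero_sub]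
  have hf : ((p / 8).factorial : ZMod p) ≠ 0 := factorial_ne_zero_of_lt (by omega)
  have h8 : (8 : ZMod p) ≠ 0 := by
    have h2 : (2 : ZMod p) ≠ 0 := mod_cast natCast_ne_zero_of_coprime
      ((Nat.coprime_primes Nat.prime_two Fact.out).2 (by omega : 2 ≠ p))
    rw [show (8 : ZMod p) = 2 ^ 3 by norm_num]
    exact pow_ne_zero _ h2
  have h := dvd_hypPoly_sub_hypRemainder (e := 256) (eight_mul_betaTwo hp) hk u w hf
  exact ⟨_, mul_ne_zero (pow_ne_zero _ h8) (pow_ne_zero _ hf), h⟩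

/-- Whether `X ^ 2 - u * X - w` divides the hypergeometric factor of `ss2Star p` and has a
discriminant that is not a square. -/
def isNonsplitFactor (p u w : ℕ) : Bool :=
  (ss2StarRemainder p u w).1 % p == 0 && (ss2StarRemainder p u w).2 % p == 0 &&
    (u ^ 2 + 4 * w) ^ (p / 2) % p == p - 1

theorem natDegree_ss2Star_ne_of_isNonsplitFactor {p u w : ℕ} [Fact p.Prime] (hp : 5 ≤ p)
    (h : isNonsplitFactor p u w) : (ss2Star p).natDegree ≠ L2Star p := by
  intro hdeg
  simp only [isNonsplitFactor, Bool.and_eq_true, beq_iff_eq] at h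
  obtain ⟨⟨hs, ht⟩, hd⟩ := h
  obtain ⟨c, hc, hdvd⟩ := exists_dvd_mul_hypPoly_sub hp u w
  have hs' := (ZMod.natCast_eq_zero_iff _ p).2 (Nat.dvd_of_mod_eq_zero hs)
  have ht' := (ZMod.natCast_eq_zero_iff _ p).2 (Nat.dvd_of_mod_eq_zero ht)
  rw [← C_eq_natCast (ss2StarRemainder p u w).1, ← C_eq_natCast (ss2StarRemainder p u w).2, hs',
    ht', C_0, zero_mul, add_zero, sub_zero, (isUnit_C.2 hc.isUnit).dvd_mul_left] at hdvd
  have hX : (X ^ p - X : (ZMod p)[X]) ≠ 0 :=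
    FiniteField.X_pow_card_sub_X_ne_zero _ (Fact.out : p.Prime).one_lt
  have hspl : (X ^ p - X : (ZMod p)[X]).Splits := by
    have := FiniteField.roots_X_pow_card_sub_X (ZMod p)
    rw [ZMod.card] at this
    rw [splits_iff_card_roots, this,
      FiniteField.X_pow_card_sub_X_natDegree_eq _ (Fact.out : p.Prime).one_lt]
    simp [ZMod.card]
  have hq : (X ^ 2 - (u : (ZMod p)[X]) * X - (w : (ZMod p)[X])).natDegree = 2 := by
    rw [← C_eq_natCast, ← C_eq_natCast]
    compute_degree!
  have hqs := hspl.of_dvd hX (hdvd.trans (hypPoly_dvd_X_pow_char_sub_X hdeg))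
  obtain ⟨x, hx⟩ := hqs.exists_eval_eq_zero
    (by rw [degree_eq_natDegree (by rintro h0; simp [h0] at hq), hq]; decide)
  simp at hx
  have hsq : IsSquare ((u ^ 2 + 4 * w : ℕ) : ZMod p) := by
    refine ⟨2 * x - u, ?_⟩
    push_cast
    linear_combination -4 * hx
  have hd' : ((u ^ 2 + 4 * w : ℕ) : ZMod p) ^ (p / 2) = -1 := by
    have := congrArg (Nat.cast (R := ZMod p)) hd
    rwa [ZMod.natCast_mod, Nat.cast_pow, Nat.cast_sub (by omega), CharP.cast_eq_zero (ZMod p) p,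
      Nat.cast_one, zero_sub] at this
  have hne : ((u ^ 2 + 4 * w : ℕ) : ZMod p) ≠ 0 := by
    intro h0
    rw [h0, zero_pow (by omega)] at hd'
    simp at hd'
  rw [ZMod.euler_criterion p hne, hd'] at hsq
  have : Fact (2 < p) := ⟨by omega⟩
  exact ZMod.neg_one_ne_one hsq

/-- Whether `x` is a root of `ss2Star p`. -/
def isSS2StarRoot (p x : ℕ) : Bool :=
  (p % 4 == 3 && x == 0) || (p % 8 / 4 == 1 && x == 256 % p) ||
    ((ss2StarRemainder p x 0).1 * x + (ss2StarRemainder p x 0).2) % p == 0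

theorem isRoot_of_isSS2StarRoot {p x : ℕ} [Fact p.Prime] (hp : 5 ≤ p) (h : isSS2StarRoot p x) :
    (ss2Star p).IsRoot (x : ZMod p) := by
  rw [ss2Star_eq, IsRoot.def, eval_mul, eval_mul, mul_eq_zero, mul_eq_zero]
  simp only [isSS2StarRoot, Bool.or_eq_true, Bool.and_eq_true, beq_iff_eq] at h
  rcases h with (⟨h, rfl⟩ | ⟨h, rfl⟩) | h
  · simp [eps_eq hp, h]
  · simp [nu_eq hp, h]
  · right; right
    obtain ⟨c, hc, q, hq⟩ := exists_dvd_mul_hypPoly_sub hp x 0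
    have h1 := (ZMod.natCast_eq_zero_iff _ p).2 (Nat.dvd_of_mod_eq_zero h)
    push_cast at h1
    have h2 := congrArg (eval (x : ZMod p)) hq
    simp at h2
    refine (mul_eq_zero.1 ?_).resolve_left hc
    linear_combination h2 + h1

theorem natDegree_ss2Star_eq_of_le_card {p : ℕ} [Fact p.Prime] (hp : 5 ≤ p)
    (h : p % 8 / 4 + (p % 4 / 2 + p / 8) ≤ ((Finset.range p).filter (isSS2StarRoot p ·)).card) :
    (ss2Star p).natDegree = L2Star p := by
  refine le_antisymm ?_ ((Multiset.toFinset_card_le _).trans (card_roots' _))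
  rw [natDegree_ss2Star, eps_eq hp, nu_eq hp]
  refine h.trans (Finset.card_le_card_of_injOn (Nat.cast : ℕ → ZMod p) (fun x hx => ?_) ?_)
  · rw [Finset.mem_coe, Finset.mem_filter] at hx
    rw [Finset.mem_coe, Multiset.mem_toFinset, mem_roots (ss2Star_ne_zero p)]
    exact isRoot_of_isSS2StarRoot hp hx.2
  · refine (CharP.natCast_injOn_Iio (ZMod p) p).mono fun x hx => ?_
    rw [Finset.mem_coe, Finset.mem_filter] at hx
    simpa using hx.1

/-- Triples `(p, u, w)` such that `X ^ 2 - u * X - w` is an irreducible factor of `ss2Star p`. -/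
def nonsplitFactors : List (ℕ × ℕ × ℕ) :=
  [(29, 4, 22), (37, 23, 3), (41, 2, 23), (43, 36, 19), (53, 51, 17), (59, 30, 42), (61, 49, 19),
   (67, 54, 46), (71, 65, 59), (73, 42, 57), (79, 24, 61), (83, 4, 76), (89, 29, 73),
   (97, 62, 93), (101, 99, 65), (103, 43, 62), (107, 96, 93), (109, 19, 104), (113, 37, 111),
   (127, 120, 75), (131, 130, 128), (137, 3, 122), (139, 121, 111), (149, 145, 148),
   (151, 17, 149), (157, 126, 118), (163, 22, 162), (167, 13, 82), (173, 86, 122),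
   (179, 40, 175), (181, 72, 176), (191, 80, 185), (193, 63, 184), (197, 133, 169),
   (199, 74, 197), (211, 130, 192), (223, 146, 216), (227, 206, 202), (229, 120, 228),
   (233, 73, 232), (239, 184, 210), (241, 101, 237), (251, 158, 247), (257, 254, 256),
   (263, 69, 236), (269, 22, 264), (271, 175, 194), (277, 68, 274), (281, 141, 280),
   (283, 282, 234), (293, 162, 276), (307, 239, 298), (311, 2, 308), (313, 133, 304),
   (317, 144, 283), (331, 172, 315), (337, 224, 333), (347, 45, 335), (349, 152, 324),
   (353, 25, 352), (359, 58, 353), (367, 335, 230), (373, 225, 361), (379, 19, 378),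
   (383, 31, 358), (389, 72, 383), (397, 44, 387), (401, 253, 387), (409, 357, 403),
   (419, 161, 415), (421, 155, 420), (431, 111, 413), (433, 193, 432), (439, 51, 432),
   (443, 133, 431), (449, 270, 448), (457, 94, 451), (461, 407, 436), (463, 320, 413),
   (467, 111, 458), (479, 207, 472), (487, 283, 486), (491, 321, 475), (499, 215, 477),
   (503, 338, 491), (509, 395, 489), (521, 23, 496), (523, 202, 457), (541, 477, 538)]

theorem isNonsplitFactor_of_mem :
    ∀ t ∈ nonsplitFactors, isNonsplitFactor t.1 t.2.1 t.2.2 := by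
  decide +kernel

theorem exists_nonsplitFactor : ∀ p < 547, 5 ≤ p →
    p ∈ [5, 7, 11, 13, 17, 19, 23, 31, 47] ∨
      (∃ d ∈ [2, 3, 5, 7, 11, 13, 17, 19, 23], d ∣ p ∧ d ≠ p) ∨
      ∃ t ∈ nonsplitFactors, t.1 = p := by
  decide +kernel

theorem natDegree_ss2Star_eq_of_mem {p : ℕ} [Fact p.Prime]
    (h : p ∈ [5, 7, 11, 13, 17, 19, 23, 31, 47]) : (ss2Star p).natDegree = L2Star p := by
  have h1 : ∀ p ∈ [5, 7, 11, 13, 17, 19, 23, 31, 47], 5 ≤ p ∧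
      p % 8 / 4 + (p % 4 / 2 + p / 8) ≤ ((Finset.range p).filter (isSS2StarRoot p ·)).card := by
    decide +kernel
  exact natDegree_ss2Star_eq_of_le_card (h1 p h).1 (h1 p h).2

theorem mem_of_natDegree_ss2Star_eq {p : ℕ} [Fact p.Prime] (hp : 5 ≤ p)
    (h : (ss2Star p).natDegree = L2Star p) : p ∈ [5, 7, 11, 13, 17, 19, 23, 31, 47] := by
  rcases exists_nonsplitFactor p (not_le.1 fun h' => natDegree_ss2Star_ne_of_le h' h) hp with
    h1 | ⟨d, hd, hdp, hne⟩ | ⟨t, ht, rfl⟩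
  · exact h1
  · rcases (Nat.dvd_prime Fact.out).1 hdp with rfl | rfl
    · simp at hd
    · exact absurd rfl hne
  · exact absurd h (natDegree_ss2Star_ne_of_isNonsplitFactor hp (isNonsplitFactor_of_mem t ht))

theorem dvd_babyMonsterOrder_iff {p : ℕ} (hpp : p.Prime) (hp : 5 ≤ p) :
    p ∣ babyMonsterOrder ↔ p ∈ [5, 7, 11, 13, 17, 19, 23, 31, 47] := by
  have key {q : ℕ} (hq : q.Prime) : p ∣ q ↔ p = q := Nat.prime_dvd_prime_iff_eq hpp hq
  have key' {q n : ℕ} (hq : q.Prime) (hn : n ≠ 0) : p ∣ q ^ n ↔ p = q := by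
    rw [hpp.prime.dvd_pow_iff_dvd hn, key hq]
  have h2 : p ≠ 2 := by omega
  have h3 : p ≠ 3 := by omega
  simp only [babyMonsterOrder, hpp.dvd_mul]
  rw [key' Nat.prime_two (by norm_num), key' Nat.prime_three (by norm_num),
    key' Nat.prime_five (by norm_num), key' (q := 7) (by norm_num) (by norm_num),
    key (q := 11) (by norm_num), key (q := 13) (by norm_num), key (q := 17) (by norm_num),
    key (q := 19) (by norm_num), key (q := 23) (by norm_num), key (q := 31) (by norm_num),
    key (q := 47) (by norm_num)]
  simp [h2, h3, or_assoc]

/-- For every prime p ≥ 5, deg ss_p^{(2*)}(X) = L^{(2*)}(p) if and only if p divides the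
order of the Baby monster group 𝔹. -/
theorem deg_ss2star_eq_L2star_iff_dvd_babyMonster (hp : 5 ≤ p) :
    (ss2Star p).natDegree = L2Star p ↔ p ∣ babyMonsterOrder := by
  rw [dvd_babyMonsterOrder_iff Fact.out hp]
  exact ⟨mem_of_natDegree_ss2Star_eq hp, natDegree_ss2Star_eq_of_mem⟩
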